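/- (Homogeneous chain with parameter-independent creation operators, XXX case.) In the setting of the local-structure theorem for the XXX case, assume additionally that the chain is homogeneous, ξ₁ = ⋯ = ξ_N = ξ, that for each j the operator Bⱼ(λ) = Bⱼ is independent of λ ∈ Λ, and that α(λ_l,ξ) ≠ 0 and δ(λ_l,ξ) ≠ 0 for l = 1, …, M. Then for pairwise distinct λ₁, …, λ_M ∈ Λ: B(λ₁)⋯B(λ_M)|0⟩ = ( ∏_{l=1}^M δ(λ_l,ξ)^N / α(λ_l,ξ) ) Σ_{1≤n₁<⋯<n_M≤N} B_{n₁}B_{n₂}⋯B_{n_M}|0⟩ × Σ_{σ ∈ S_M} ( ∏_{1≤i<j≤M} f(λ_{σ(i)},λ_{σ(j)}) ) ∏_{k=1}^M ( α(λ_{σ(k)},ξ)/δ(λ_{σ(k)},ξ) )^{n_k}, where f(λ,μ) = (λ−μ+1)/(λ−μ), S_M is the symmetric group on {1,…,M}, and B(λ) is the (1,2) entry of T(λ) = L₁(λ)⋯L_N(λ). -/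

import Mathlib

open scoped BigOperators

noncomputable section

/-- The endomorphism algebra of a complex vector space `H`. -/
abbrev EndH (H : Type) [AddCommGroup H] [Module ℂ H] := Module.End ℂ H

/-- The 4×4 matrix `[[f,0,0,0],[0,1,g,0],[0,g,1,0],[0,0,0,f]]` acting on `ℂ² ⊗ ℂ²`,
indexed by `Fin 2 × Fin 2` (standard tensor basis). -/
def Rfg (f g : ℂ) : Matrix (Fin 2 × Fin 2) (Fin 2 × Fin 2) ℂ :=
  fun p q =>
    if p = q then (if p.1 = p.2 then f else 1)
    else if p.1 = q.2 ∧ p.2 = q.1 then g else 0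

/-- Rational function `f(λ,μ) = (λ-μ+1)/(λ-μ)`. -/
def fXXX (l m : ℂ) : ℂ := (l - m + 1) / (l - m)

/-- Rational function `g(λ,μ) = 1/(λ-μ)`. -/
def gXXX (l m : ℂ) : ℂ := 1 / (l - m)

/-- The rational (XXX-type) R-matrix. -/
def RXXX (l m : ℂ) : Matrix (Fin 2 × Fin 2) (Fin 2 × Fin 2) ℂ := Rfg (fXXX l m) (gXXX l m)

/-- Trigonometric `f(λ,μ) = sinh(λ-μ+η)/sinh(λ-μ)`. -/
def fXXZ (η l m : ℂ) : ℂ := Complex.sinh (l - m + η) / Complex.sinh (l - m)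

/-- Trigonometric `g(λ,μ) = sinh η / sinh(λ-μ)`. -/
def gXXZ (η l m : ℂ) : ℂ := Complex.sinh η / Complex.sinh (l - m)

/-- The trigonometric (XXZ-type) R-matrix with anisotropy `η`. -/
def RXXZ (η l m : ℂ) : Matrix (Fin 2 × Fin 2) (Fin 2 × Fin 2) ℂ :=
  Rfg (fXXZ η l m) (gXXZ η l m)

variable {H : Type} [AddCommGroup H] [Module ℂ H]

/-- `T₁(λ)`: the 2×2 operator matrix `T` acting in the first auxiliary space `ℂ²`
(and in `H`), identity in the second auxiliary space. -/
def aux1 (T : Matrix (Fin 2) (Fin 2) (EndH H)) :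
    Matrix (Fin 2 × Fin 2) (Fin 2 × Fin 2) (EndH H) :=
  fun p q => if p.2 = q.2 then T p.1 q.1 else 0

/-- `T₂(μ)`: the 2×2 operator matrix `T` acting in the second auxiliary space `ℂ²`
(and in `H`), identity in the first auxiliary space. -/
def aux2 (T : Matrix (Fin 2) (Fin 2) (EndH H)) :
    Matrix (Fin 2 × Fin 2) (Fin 2 × Fin 2) (EndH H) :=
  fun p q => if p.1 = q.1 then T p.2 q.2 else 0

/-- A scalar 4×4 matrix viewed as a matrix of endomorphisms of `H`
(i.e. `R ⊗ id_H` on `ℂ² ⊗ ℂ² ⊗ H`). -/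
def embedR (R : Matrix (Fin 2 × Fin 2) (Fin 2 × Fin 2) ℂ) :
    Matrix (Fin 2 × Fin 2) (Fin 2 × Fin 2) (EndH H) :=
  R.map (fun c => c • (1 : EndH H))

/-- The RTT relation `R₁₂(λ,μ) T₁(λ) T₂(μ) = T₂(μ) T₁(λ) R₁₂(λ,μ)` in
`End(ℂ² ⊗ ℂ² ⊗ H)`, for all `λ, μ ∈ Λ` which are admissible (`adm λ μ`). -/
def SatisfiesRTT (Λ : Set ℂ) (adm : ℂ → ℂ → Prop)
    (R : ℂ → ℂ → Matrix (Fin 2 × Fin 2) (Fin 2 × Fin 2) ℂ)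
    (T : ℂ → Matrix (Fin 2) (Fin 2) (EndH H)) : Prop :=
  ∀ lam mu : ℂ, lam ∈ Λ → mu ∈ Λ → adm lam mu →
    embedR (R lam mu) * aux1 (T lam) * aux2 (T mu)
      = aux2 (T mu) * aux1 (T lam) * embedR (R lam mu)

/-- Ordered product `∏_{k ∈ s} B k` of endomorphisms indexed by a finset of a linearly
ordered type, taken in increasing order of the index. -/
def finsetOpProd {ι : Type} [LinearOrder ι] (s : Finset ι) (B : ι → EndH H) : EndH H :=
  ((s.sort (· ≤ ·)).map B).prod


lemma fXXX_eq_one_add_gXXX {x y : ℂ} (h : x ≠ y) : fXXX x y = 1 + gXXX x y := by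
  have : x - y ≠ 0 := sub_ne_zero.mpr h
  simp only [fXXX, gXXX]
  field_simp

lemma gXXX_antisymm (x y : ℂ) : gXXX x y = -gXXX y x := by
  simp only [gXXX]
  rw [← neg_sub y x, div_neg]

lemma aux1_mul (S T : Matrix (Fin 2) (Fin 2) (EndH H)) : aux1 (S * T) = aux1 S * aux1 T := by
  ext1 p q
  simp only [aux1, Matrix.mul_apply, Fintype.sum_prod_type, Fin.sum_univ_two]
  obtain ⟨i, k⟩ := p
  obtain ⟨j, l⟩ := q
  fin_cases k <;> fin_cases l <;> simp

lemma aux2_mul (S T : Matrix (Fin 2) (Fin 2) (EndH H)) : aux2 (S * T) = aux2 S * aux2 T := by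
  ext1 p q
  simp only [aux2, Matrix.mul_apply, Fintype.sum_prod_type, Fin.sum_univ_two]
  obtain ⟨i, k⟩ := p
  obtain ⟨j, l⟩ := q
  fin_cases i <;> fin_cases j <;> simp

lemma aux1_mul_aux2_apply (S T : Matrix (Fin 2) (Fin 2) (EndH H)) (i j k l : Fin 2) :
    (aux1 S * aux2 T) (i, k) (j, l) = S i j * T k l := by
  simp [aux1, aux2, Matrix.mul_apply, Fintype.sum_prod_type]

lemma aux2_mul_aux1_apply (S T : Matrix (Fin 2) (Fin 2) (EndH H)) (i j k l : Fin 2) :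
    (aux2 T * aux1 S) (i, k) (j, l) = T k l * S i j := by
  simp [aux1, aux2, Matrix.mul_apply, Fintype.sum_prod_type]

lemma aux1_commute_aux2 {S T : Matrix (Fin 2) (Fin 2) (EndH H)}
    (h : ∀ a b c d, Commute (S a b) (T c d)) : Commute (aux1 S) (aux2 T) := by
  ext1 ⟨i, k⟩ ⟨j, l⟩
  rw [aux1_mul_aux2_apply, aux2_mul_aux1_apply]
  exact h _ _ _ _

lemma SatisfiesRTT.mul {Λ : Set ℂ} {adm : ℂ → ℂ → Prop}
    {R : ℂ → ℂ → Matrix (Fin 2 × Fin 2) (Fin 2 × Fin 2) ℂ}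
    {S T : ℂ → Matrix (Fin 2) (Fin 2) (EndH H)}
    (hS : SatisfiesRTT Λ adm R S) (hT : SatisfiesRTT Λ adm R T)
    (h : ∀ x ∈ Λ, ∀ y ∈ Λ, ∀ a b c d, Commute (S x a b) (T y c d)) :
    SatisfiesRTT Λ adm R (fun x => S x * T x) := by
  intro x y hx hy hxy
  have h₁ : Commute (aux1 (T x)) (aux2 (S y)) :=
    aux1_commute_aux2 fun a b c d => (h y hy x hx c d a b).symm
  have h₂ : Commute (aux1 (S x)) (aux2 (T y)) :=
    aux1_commute_aux2 fun a b c d => h x hx y hy a b c d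
  calc embedR (R x y) * aux1 (S x * T x) * aux2 (S y * T y)
      = embedR (R x y) * aux1 (S x) * (aux1 (T x) * aux2 (S y)) * aux2 (T y) := by
        simp only [aux1_mul, aux2_mul, mul_assoc]
    _ = (embedR (R x y) * aux1 (S x) * aux2 (S y)) * (aux1 (T x) * aux2 (T y)) := by
        rw [h₁.eq]; simp only [mul_assoc]
    _ = aux2 (S y) * aux1 (S x) * (embedR (R x y) * aux1 (T x) * aux2 (T y)) := by
        rw [hS x y hx hy hxy]; simp only [mul_assoc]
    _ = aux2 (S y) * (aux1 (S x) * aux2 (T y)) * aux1 (T x) * embedR (R x y) := by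
        rw [hT x y hx hy hxy]; simp only [mul_assoc]
    _ = aux2 (S y * T y) * aux1 (S x * T x) * embedR (R x y) := by
        rw [h₂.eq]; simp only [aux1_mul, aux2_mul, mul_assoc]

lemma RXXX_eq {x y : ℂ} (h : x ≠ y) :
    RXXX x y = 1 + gXXX x y • Matrix.of fun p q => if p.swap = q then 1 else 0 := by
  ext1 ⟨i, k⟩ ⟨j, l⟩
  simp only [RXXX, Rfg, fXXX_eq_one_add_gXXX h]
  fin_cases i <;> fin_cases j <;> fin_cases k <;> fin_cases l <;> simp

/-- The component form of the RTT relation for the rational R-matrix. -/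
lemma SatisfiesRTT.commutator {Λ : Set ℂ} {T : ℂ → Matrix (Fin 2) (Fin 2) (EndH H)}
    (hT : SatisfiesRTT Λ (fun x y => x ≠ y) RXXX T) {x y : ℂ} (hx : x ∈ Λ) (hy : y ∈ Λ)
    (hxy : x ≠ y) (i j k l : Fin 2) :
    T x i j * T y k l - T y k l * T x i j
      = gXXX x y • (T y k j * T x i l - T x k j * T y i l) := by
  have h := congrFun (congrFun (hT x y hx hy hxy) (i, k)) (j, l)
  rw [RXXX_eq hxy, mul_assoc, Matrix.mul_apply, Matrix.mul_apply] at h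
  simp only [aux1_mul_aux2_apply, aux2_mul_aux1_apply, embedR, Matrix.map_apply,
    Fintype.sum_prod_type, Matrix.add_apply, Matrix.smul_apply, Matrix.of_apply,
    Matrix.one_apply, Prod.mk.injEq, Prod.swap_prod_mk, smul_eq_mul, add_smul,
    Fin.sum_univ_two] at h
  rw [smul_sub, sub_eq_sub_iff_add_eq_add]
  fin_cases i <;> fin_cases j <;> fin_cases k <;> fin_cases l <;>
    simp [add_mul, mul_add] at h ⊢ <;> first | exact h | (rw [add_comm, h, add_comm]) | (rw [h, add_comm])

lemma SatisfiesRTT.commute_B {Λ : Set ℂ} {T : ℂ → Matrix (Fin 2) (Fin 2) (EndH H)}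
    (hT : SatisfiesRTT Λ (fun x y => x ≠ y) RXXX T) {x y : ℂ} (hx : x ∈ Λ) (hy : y ∈ Λ) :
    Commute (T x 0 1) (T y 0 1) := by
  rcases eq_or_ne x y with rfl | hxy
  · exact Commute.refl _
  have h₁ := hT.commutator hx hy hxy 0 1 0 1
  have h₂ := hT.commutator hy hx hxy.symm 0 1 0 1
  rw [gXXX_antisymm] at h₂
  have hs : (2 : ℂ) • (T x 0 1 * T y 0 1 - T y 0 1 * T x 0 1) = 0 := by
    refine Eq.trans ?_ ((congrArg₂ (fun p q => p - q) h₁ h₂).trans ?_) <;> module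
  exact sub_eq_zero.mp ((smul_eq_zero.mp hs).resolve_left two_ne_zero)

lemma SatisfiesRTT.D_mul_B {Λ : Set ℂ} {T : ℂ → Matrix (Fin 2) (Fin 2) (EndH H)}
    (hT : SatisfiesRTT Λ (fun x y => x ≠ y) RXXX T) {x y : ℂ} (hx : x ∈ Λ) (hy : y ∈ Λ)
    (hxy : x ≠ y) :
    T x 1 1 * T y 0 1 = fXXX x y • (T y 0 1 * T x 1 1) + gXXX y x • (T x 0 1 * T y 1 1) := by
  have h := hT.commutator hx hy hxy 1 1 0 1
  rw [fXXX_eq_one_add_gXXX hxy, gXXX_antisymm y x, eq_add_of_sub_eq h]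
  module

lemma ofFn_prod_apply_comm {M : ℕ} {X : EndH H} {B : Fin M → EndH H}
    (h : ∀ i, Commute X (B i)) (v : H) :
    X ((List.ofFn B).prod v) = (List.ofFn B).prod (X v) := by
  have : Commute X (List.ofFn B).prod := Commute.list_prod_right _ _ (by
    intro y hy
    obtain ⟨i, rfl⟩ := (List.mem_ofFn' _ _).mp hy
    exact h i)
  exact LinearMap.congr_fun this.eq v

/-- Action of `D` on an off-shell Bethe vector. -/
lemma D_apply_bethe {Λ : Set ℂ} {B D : ℂ → EndH H} {v : H} {d : ℂ → ℂ}
    (hB : ∀ x ∈ Λ, ∀ y ∈ Λ, Commute (B x) (B y))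
    (hDB : ∀ x ∈ Λ, ∀ y ∈ Λ, x ≠ y →
      D x * B y = fXXX x y • (B y * D x) + gXXX y x • (B x * D y))
    (hD : ∀ x ∈ Λ, D x v = d x • v) (M : ℕ) :
    ∀ (x : ℂ) (u : Fin (M + 1) → ℂ), x ∈ Λ → (∀ i, u i ∈ Λ) → (∀ i, x ≠ u i) →
      Function.Injective u →
      D x ((List.ofFn fun i => B (u i)).prod v)
        = (d x * ∏ i, fXXX x (u i)) • (List.ofFn fun i => B (u i)).prod v
          + ∑ k, (gXXX (u k) x * d (u k) * ∏ j, fXXX (u k) (u (k.succAbove j))) •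
              B x ((List.ofFn fun j => B (u (k.succAbove j))).prod v) := by
  induction M with
  | zero =>
    intro x u hx hu hxu _
    have h := LinearMap.congr_fun (hDB x hx (u 0) (hu 0) (hxu 0)) v
    simp only [Module.End.mul_apply, LinearMap.add_apply, LinearMap.smul_apply, hD x hx,
      hD _ (hu 0), map_smul] at h
    simp [h, smul_smul, mul_comm]
  | succ M ih =>
    intro x u hx hu hxu hinj
    have hne : ∀ i : Fin (M + 1), u 0 ≠ u i.succ := fun i h => Fin.succ_ne_zero i (hinj h).symm
    have ih₁ := ih x (fun i => u i.succ) hx (fun i => hu _) (fun i => hxu _)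
      (hinj.comp (Fin.succ_injective _))
    have ih₂ := ih (u 0) (fun i => u i.succ) (hu 0) (fun i => hu _) hne
      (hinj.comp (Fin.succ_injective _))
    have hcons : ∀ w : Fin (M + 2) → ℂ, (List.ofFn fun i => B (w i)).prod v
        = B (w 0) ((List.ofFn fun i : Fin (M + 1) => B (w i.succ)).prod v) := by
      intro w; simp [List.ofFn_succ]
    have h := LinearMap.congr_fun (hDB x hx (u 0) (hu 0) (hxu 0))
      ((List.ofFn fun i : Fin (M + 1) => B (u i.succ)).prod v)
    simp only [Module.End.mul_apply, LinearMap.add_apply, LinearMap.smul_apply] at h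
    rw [hcons u, h, ih₁, ih₂, Fin.sum_univ_succ (n := M + 1)]
    have hcons' : ∀ k : Fin (M + 1),
        (List.ofFn fun j : Fin (M + 1) => B (u (k.succ.succAbove j))).prod v
          = B (u 0) ((List.ofFn fun j : Fin M => B (u (k.succAbove j).succ)).prod v) := by
      intro k; simp [List.ofFn_succ]
    have hBc : ∀ w : H, B x (B (u 0) w) = B (u 0) (B x w) := fun w =>
      LinearMap.congr_fun (hB x hx (u 0) (hu 0)).eq w
    simp only [hcons', hBc, Fin.succAbove_zero, Fin.prod_univ_succ (n := M + 1),
      map_add, map_sum, map_smul, smul_add, Finset.smul_sum, smul_smul]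
    have hsum : ∑ k : Fin (M + 1), (gXXX (u k.succ) x * d (u k.succ) *
          ∏ j, fXXX (u k.succ) (u (k.succ.succAbove j))) •
          B (u 0) (B x ((List.ofFn fun j : Fin M => B (u (k.succAbove j).succ)).prod v))
        = ∑ k : Fin (M + 1), (fXXX x (u 0) * (gXXX (u k.succ) x * d (u k.succ) *
          ∏ j, fXXX (u k.succ) (u (k.succAbove j).succ))) •
          B (u 0) (B x ((List.ofFn fun j : Fin M => B (u (k.succAbove j).succ)).prod v))
        + ∑ k : Fin (M + 1), (gXXX (u 0) x * (gXXX (u k.succ) (u 0) * d (u k.succ) *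
          ∏ j, fXXX (u k.succ) (u (k.succAbove j).succ))) •
          B (u 0) (B x ((List.ofFn fun j : Fin M => B (u (k.succAbove j).succ)).prod v)) := by
      rw [← Finset.sum_add_distrib]
      refine Finset.sum_congr rfl fun k _ => ?_
      rw [← add_smul, Fin.prod_univ_succ]
      simp only [Fin.succ_succAbove_zero, Fin.succ_succAbove_succ]
      congr 1
      have key : gXXX (u k.succ) x * fXXX (u k.succ) (u 0)
          = fXXX x (u 0) * gXXX (u k.succ) x + gXXX (u 0) x * gXXX (u k.succ) (u 0) := by
        have h₁ : u k.succ - x ≠ 0 := sub_ne_zero.mpr (hxu _).symm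
        have h₂ : u k.succ - u 0 ≠ 0 := sub_ne_zero.mpr (hne k).symm
        have h₃ : x - u 0 ≠ 0 := sub_ne_zero.mpr (hxu 0)
        rw [gXXX_antisymm (u 0) x]
        simp only [fXXX, gXXX]
        field_simp
        ring
      linear_combination (d (u k.succ) * ∏ j, fXXX (u k.succ) (u (k.succAbove j).succ)) * key
    rw [hsum]
    module

/-- Splitting the first site off an off-shell Bethe vector. -/
lemma bethe_split_first {Λ : Set ℂ} {A B D : ℂ → EndH H} {b : EndH H} {v : H} {a d : ℂ → ℂ}
    (hB : ∀ x ∈ Λ, ∀ y ∈ Λ, Commute (B x) (B y))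
    (hDB : ∀ x ∈ Λ, ∀ y ∈ Λ, x ≠ y →
      D x * B y = fXXX x y • (B y * D x) + gXXX y x • (B x * D y))
    (hD : ∀ x ∈ Λ, D x v = d x • v) (hA : ∀ x ∈ Λ, A x v = a x • v)
    (hAb : ∀ x ∈ Λ, ∀ y ∈ Λ, x ≠ y →
      A x (b v) = (a x * fXXX y x - a y * gXXX y x) • b v)
    (hbb : b (b v) = 0)
    (hAB : ∀ x ∈ Λ, ∀ y ∈ Λ, Commute (A x) (B y))
    (hbB : ∀ y ∈ Λ, Commute b (B y)) (hbD : ∀ y ∈ Λ, Commute b (D y)) (M : ℕ) :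
    ∀ u : Fin (M + 1) → ℂ, (∀ i, u i ∈ Λ) → Function.Injective u →
      (List.ofFn fun i => A (u i) * B (u i) + b * D (u i)).prod v
        = (∏ i, a (u i)) • (List.ofFn fun i => B (u i)).prod v
          + ∑ k, (d (u k) * ∏ j, (a (u (k.succAbove j)) * fXXX (u k) (u (k.succAbove j)))) •
              b ((List.ofFn fun j => B (u (k.succAbove j))).prod v) := by
  induction M with
  | zero =>
    intro u hu _
    have h := LinearMap.congr_fun (hAB _ (hu 0) _ (hu 0)).eq v
    simp only [Module.End.mul_apply, hA _ (hu 0), map_smul] at h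
    simp [h, hD _ (hu 0)]
  | succ M ih =>
    intro u hu hinj
    have hne : ∀ i : Fin (M + 1), u 0 ≠ u i.succ := fun i h => Fin.succ_ne_zero i (hinj h).symm
    have ih' := ih (fun i => u i.succ) (fun i => hu _) (hinj.comp (Fin.succ_injective _))
    have hDv := D_apply_bethe hB hDB hD M (u 0) (fun i => u i.succ) (hu 0) (fun i => hu _) hne
      (hinj.comp (Fin.succ_injective _))
    rw [List.ofFn_succ, List.prod_cons, Module.End.mul_apply, ih']
    have hcons : (List.ofFn fun i => B (u i)).prod v
        = B (u 0) ((List.ofFn fun i : Fin (M + 1) => B (u i.succ)).prod v) := by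
      simp [List.ofFn_succ]
    have hcons' : ∀ k : Fin (M + 1),
        (List.ofFn fun j : Fin (M + 1) => B (u (k.succ.succAbove j))).prod v
          = B (u 0) ((List.ofFn fun j : Fin M => B (u (k.succAbove j).succ)).prod v) := by
      intro k; simp [List.ofFn_succ]
    have hcomm : ∀ X Y : EndH H, Commute X Y → ∀ w, X (Y w) = Y (X w) := fun X Y h w =>
      LinearMap.congr_fun h.eq w
    have hAB0 : (A (u 0)) (B (u 0) ((List.ofFn fun i : Fin (M + 1) => B (u i.succ)).prod v))
        = a (u 0) • B (u 0) ((List.ofFn fun i : Fin (M + 1) => B (u i.succ)).prod v) := by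
      rw [hcomm _ _ (hAB _ (hu 0) _ (hu 0)),
        ofFn_prod_apply_comm fun i => hAB _ (hu 0) _ (hu _), hA _ (hu 0), map_smul, map_smul]
    have hABb : ∀ k : Fin (M + 1),
        (A (u 0)) (B (u 0) (b ((List.ofFn fun j : Fin M => B (u (k.succAbove j).succ)).prod v)))
        = (a (u 0) * fXXX (u k.succ) (u 0) - a (u k.succ) * gXXX (u k.succ) (u 0)) •
          b (B (u 0) ((List.ofFn fun j : Fin M => B (u (k.succAbove j).succ)).prod v)) := by
      intro k
      rw [ofFn_prod_apply_comm fun i => hbB _ (hu _), hcomm _ _ (hAB _ (hu 0) _ (hu 0)),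
        ofFn_prod_apply_comm fun i => hAB _ (hu 0) _ (hu _),
        hAb _ (hu 0) _ (hu k.succ) (hne k), hcomm _ _ (hbB _ (hu 0)),
        ofFn_prod_apply_comm fun i => hbB _ (hu _)]
      simp only [map_smul]
    have hbDb : ∀ k : Fin (M + 1),
        b (D (u 0) (b ((List.ofFn fun j : Fin M => B (u (k.succAbove j).succ)).prod v))) = 0 := by
      intro k
      rw [hcomm _ _ (hbD _ (hu 0)), ofFn_prod_apply_comm fun i => hbB _ (hu _),
        ofFn_prod_apply_comm fun i => hbB _ (hu _), hbb, map_zero, map_zero]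
    rw [Fin.sum_univ_succ (n := M + 1), hcons]
    simp only [hcons', LinearMap.add_apply, Module.End.mul_apply, map_add, map_sum, map_smul,
      hAB0, hABb, hbDb, hDv, Fin.succAbove_zero, Fin.prod_univ_succ (n := M + 1),
      smul_add, Finset.smul_sum, smul_smul, add_zero]
    have hsum : ∑ k : Fin (M + 1), (d (u k.succ) *
          ∏ j, (a (u (k.succ.succAbove j)) * fXXX (u k.succ) (u (k.succ.succAbove j)))) •
          b (B (u 0) ((List.ofFn fun j : Fin M => B (u (k.succAbove j).succ)).prod v))
        = ∑ k : Fin (M + 1), (d (u k.succ) *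
          (∏ j, (a (u (k.succAbove j).succ) * fXXX (u k.succ) (u (k.succAbove j).succ))) *
          (a (u 0) * fXXX (u k.succ) (u 0) - a (u k.succ) * gXXX (u k.succ) (u 0))) •
          b (B (u 0) ((List.ofFn fun j : Fin M => B (u (k.succAbove j).succ)).prod v))
        + ∑ k : Fin (M + 1), ((∏ i : Fin (M + 1), a (u i.succ)) *
          (gXXX (u k.succ) (u 0) * d (u k.succ) *
          ∏ j, fXXX (u k.succ) (u (k.succAbove j).succ))) •
          b (B (u 0) ((List.ofFn fun j : Fin M => B (u (k.succAbove j).succ)).prod v)) := by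
      rw [← Finset.sum_add_distrib]
      refine Finset.sum_congr rfl fun k _ => ?_
      rw [← add_smul, Fin.prod_univ_succ, Fin.prod_univ_succAbove _ k]
      simp only [Fin.succ_succAbove_zero, Fin.succ_succAbove_succ, Finset.prod_mul_distrib]
      congr 1
      ring
    rw [hsum, Finset.prod_mul_distrib]
    module

/-- A permutation of `Fin (M + 1)` is a choice of the image of `0` together with a permutation
of `Fin M`. -/
lemma sum_perm_fin_succ {M : ℕ} (F : Equiv.Perm (Fin (M + 1)) → ℂ) :
    ∑ σ, F σ = ∑ k : Fin (M + 1), ∑ e : Equiv.Perm (Fin M),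
      F (k.cycleRange.symm * Equiv.Perm.decomposeFin.symm (0, e)) := by
  rw [← Fintype.sum_prod_type' (f := fun (k : Fin (M + 1)) (e : Equiv.Perm (Fin M)) =>
    F (k.cycleRange.symm * Equiv.Perm.decomposeFin.symm (0, e)))]
  refine (Function.Bijective.sum_comp (e := fun p : Fin (M + 1) × Equiv.Perm (Fin M) =>
    p.1.cycleRange.symm * Equiv.Perm.decomposeFin.symm (0, p.2)) ?_ F).symm
  rw [Fintype.bijective_iff_injective_and_card]
  refine ⟨?_, by simp [Fintype.card_perm, Nat.factorial_succ]⟩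
  rintro ⟨k, e⟩ ⟨k', e'⟩ h
  have h0 := congrArg (fun σ : Equiv.Perm (Fin (M + 1)) => σ 0) h
  simp only [Equiv.Perm.mul_apply, Equiv.Perm.decomposeFin_symm_apply_zero,
    Fin.cycleRange_symm_zero] at h0
  subst h0
  have := Equiv.Perm.decomposeFin.symm.injective (mul_left_cancel h)
  simpa using this

lemma cycleRange_symm_mul_zero {M : ℕ} (k : Fin (M + 1)) (e : Equiv.Perm (Fin M)) :
    (k.cycleRange.symm * Equiv.Perm.decomposeFin.symm (0, e) : Equiv.Perm (Fin (M + 1))) 0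
      = k := by
  simp

lemma cycleRange_symm_mul_succ {M : ℕ} (k : Fin (M + 1)) (e : Equiv.Perm (Fin M)) (i : Fin M) :
    (k.cycleRange.symm * Equiv.Perm.decomposeFin.symm (0, e) : Equiv.Perm (Fin (M + 1))) i.succ
      = k.succAbove (e i) := by
  simp

/-- The coordinate Bethe wave function, up to normalization, where `r = α / δ`. -/
def betheWave {M N : ℕ} (r : ℂ → ℂ) (u : Fin M → ℂ) (n : Fin M → Fin N) : ℂ :=
  ∑ σ : Equiv.Perm (Fin M),
    (∏ i : Fin M, ∏ j ∈ Finset.univ.filter (fun j : Fin M => i < j),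
        fXXX (u (σ i)) (u (σ j))) *
      ∏ k : Fin M, r (u (σ k)) ^ ((n k : ℕ) + 1)

lemma betheWave_succ {M N : ℕ} (r : ℂ → ℂ) (u : Fin M → ℂ) (n : Fin M → Fin N) :
    betheWave r u (fun k => (n k).succ) = (∏ k, r (u k)) * betheWave r u n := by
  simp only [betheWave, Finset.mul_sum]
  refine Finset.sum_congr rfl fun σ _ => ?_
  simp only [Fin.val_succ, pow_succ _ (_ + 1), Finset.prod_mul_distrib]
  rw [Equiv.prod_comp σ fun k => r (u k)]
  ring

lemma betheWave_cons_zero {M N : ℕ} (r : ℂ → ℂ) (u : Fin (M + 1) → ℂ) (n : Fin M → Fin N) :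
    betheWave r u (Fin.cons 0 fun k => (n k).succ : Fin (M + 1) → Fin (N + 1))
      = ∑ k, (∏ j, fXXX (u k) (u (k.succAbove j))) * r (u k) *
          ((∏ j, r (u (k.succAbove j))) * betheWave r (fun j => u (k.succAbove j)) n) := by
  rw [betheWave, sum_perm_fin_succ]
  refine Finset.sum_congr rfl fun k _ => ?_
  rw [← betheWave_succ, betheWave, Finset.mul_sum]
  refine Finset.sum_congr rfl fun e _ => ?_
  simp only [Finset.prod_filter, Fin.prod_univ_succ, cycleRange_symm_mul_zero,
    cycleRange_symm_mul_succ, Fin.cons_zero, Fin.cons_succ, Fin.succ_lt_succ_iff,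
    Fin.succ_pos, Fin.not_lt_zero, if_true, if_false, one_mul, Fin.val_zero,
    zero_add, pow_one]
  rw [Equiv.prod_comp e fun j => fXXX (u k) (u (k.succAbove j))]
  ring

/-- Strictly increasing maps into `Fin (N + 1)` either avoid `0` or start at `0`. -/
lemma sum_strictMono_fin_succ {V : Type*} [AddCommMonoid V] {M N : ℕ}
    (F : (Fin (M + 1) → Fin (N + 1)) → V) :
    ∑ n ∈ Finset.univ.filter
        (fun n : Fin (M + 1) → Fin (N + 1) => ∀ k l, k < l → n k < n l), F n
      = (∑ n ∈ Finset.univ.filter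
          (fun n : Fin (M + 1) → Fin N => ∀ k l, k < l → n k < n l), F fun k => (n k).succ)
        + ∑ n ∈ Finset.univ.filter
          (fun n : Fin M → Fin N => ∀ k l, k < l → n k < n l),
            F (Fin.cons 0 fun k => (n k).succ) := by
  rw [← Finset.sum_filter_not_add_sum_filter _ fun n => n 0 = 0]
  congr 1
  · symm
    refine Finset.sum_bij (fun n _ k => (n k).succ) ?_ ?_ ?_ ?_
    · intro n hn
      simpa [Fin.succ_lt_succ_iff] using hn
    · intro n _ n' _ h
      funext k
      exact Fin.succ_injective _ (congrFun h k)
    · intro n hn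
      simp only [Finset.mem_filter, Finset.mem_univ, true_and] at hn
      have hpos : ∀ k, n k ≠ 0 := by
        intro k
        rcases Fin.eq_zero_or_eq_succ k with rfl | ⟨j, rfl⟩
        · exact hn.2
        · exact ((Fin.zero_le _).trans_lt (hn.1 _ _ (Fin.succ_pos j))).ne'
      refine ⟨fun k => (n k).pred (hpos k), ?_, ?_⟩
      · simpa using hn.1
      · funext k
        simp
    · intro n _
      rfl
  · symm
    refine Finset.sum_bij (fun n _ => Fin.cons 0 fun k => (n k).succ) ?_ ?_ ?_ ?_
    · intro n hn
      simpa [Fin.forall_fin_succ, Fin.succ_lt_succ_iff] using hn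
    · intro n _ n' _ h
      funext k
      exact Fin.succ_injective _ (congrFun (Fin.cons_right_injective _ h) k)
    · intro n hn
      simp only [Finset.mem_filter, Finset.mem_univ, true_and] at hn
      have hpos : ∀ k : Fin M, n k.succ ≠ 0 := fun k =>
        ((Fin.zero_le _).trans_lt (hn.1 _ _ (Fin.succ_pos k))).ne'
      refine ⟨fun k => (n k.succ).pred (hpos k), ?_, ?_⟩
      · simpa using fun (k l : Fin M) h => hn.1 k.succ l.succ (Fin.succ_lt_succ_iff.mpr h)
      · funext k
        rcases Fin.eq_zero_or_eq_succ k with rfl | ⟨j, rfl⟩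
        · simp [hn.2]
        · simp
    · intro n _
      rfl

/-- The monodromy matrix of a chain with local L-operators `L`. -/
abbrev monodromy {N : ℕ} (L : Fin N → ℂ → Matrix (Fin 2) (Fin 2) (EndH H)) (x : ℂ) :
    Matrix (Fin 2) (Fin 2) (EndH H) :=
  (List.ofFn fun j => L j x).prod

lemma monodromy_succ {N : ℕ} (L : Fin (N + 1) → ℂ → Matrix (Fin 2) (Fin 2) (EndH H)) (x : ℂ) :
    monodromy L x = L 0 x * monodromy (fun j => L j.succ) x := by
  simp [monodromy, List.ofFn_succ]

lemma commute_monodromy {N : ℕ} {L : Fin N → ℂ → Matrix (Fin 2) (Fin 2) (EndH H)} {x : ℂ}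
    {X : EndH H} (h : ∀ j a b, Commute X (L j x a b)) (a b : Fin 2) :
    Commute X (monodromy L x a b) := by
  induction N generalizing a b with
  | zero =>
    simp only [monodromy, List.ofFn_zero, List.prod_nil, Matrix.one_apply]
    split_ifs
    exacts [Commute.one_right _, Commute.zero_right _]
  | succ N ih =>
    rw [monodromy_succ, Matrix.mul_apply]
    exact Commute.sum_right _ _ _ fun c _ =>
      (h _ _ _).mul_right (ih (fun j => h j.succ) _ _)

lemma monodromy_satisfiesRTT {N : ℕ} {Λ : Set ℂ}
    {L : Fin N → ℂ → Matrix (Fin 2) (Fin 2) (EndH H)} {adm : ℂ → ℂ → Prop}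
    {R : ℂ → ℂ → Matrix (Fin 2 × Fin 2) (Fin 2 × Fin 2) ℂ}
    (hRTT : ∀ j, SatisfiesRTT Λ adm R (L j))
    (hcomm : ∀ i j, i ≠ j → ∀ x y, x ∈ Λ → y ∈ Λ →
      ∀ a b c d, Commute (L i x a b) (L j y c d)) :
    SatisfiesRTT Λ adm R (monodromy L) := by
  induction N with
  | zero =>
    intro x y _ _ _
    have h₁ : aux1 (1 : Matrix (Fin 2) (Fin 2) (EndH H)) = 1 := by
      ext1 ⟨i, k⟩ ⟨j, l⟩
      simp only [aux1, Matrix.one_apply, Prod.mk.injEq]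
      split_ifs <;> simp_all
    have h₂ : aux2 (1 : Matrix (Fin 2) (Fin 2) (EndH H)) = 1 := by
      ext1 ⟨i, k⟩ ⟨j, l⟩
      simp only [aux2, Matrix.one_apply, Prod.mk.injEq]
      split_ifs <;> simp_all
    simp [monodromy, h₁, h₂]
  | succ N ih =>
    have ih' := ih (fun j => hRTT j.succ) fun i j hij =>
      hcomm i.succ j.succ fun h => hij (Fin.succ_injective _ h)
    have h := (hRTT 0).mul ih' fun x hx y hy a b c d =>
      commute_monodromy
        (fun j a' b' => hcomm 0 j.succ (Fin.succ_ne_zero j).symm x y hx hy a b a' b') c d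
    exact (funext (monodromy_succ L)).symm ▸ h

lemma monodromy_lower_apply {N : ℕ} {L : Fin N → ℂ → Matrix (Fin 2) (Fin 2) (EndH H)} {x : ℂ}
    {v : H} {d : ℂ} (hC : ∀ j, L j x 1 0 v = 0) (hD : ∀ j, L j x 1 1 v = d • v)
    (hcomm : ∀ i j, i ≠ j → ∀ a b c d, Commute (L i x a b) (L j x c d)) :
    monodromy L x 1 0 v = 0 ∧ monodromy L x 1 1 v = d ^ N • v := by
  induction N with
  | zero => simp [monodromy]
  | succ N ih =>
    obtain ⟨ihC, ihD⟩ := ih (fun j => hC j.succ) (fun j => hD j.succ) fun i j hij =>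
      hcomm i.succ j.succ fun h => hij (Fin.succ_injective _ h)
    have h : Commute (L 0 x 1 0) (monodromy (fun j => L j.succ) x 0 0)
        ∧ Commute (L 0 x 1 0) (monodromy (fun j => L j.succ) x 0 1) :=
      ⟨commute_monodromy (fun j a b => hcomm 0 j.succ (Fin.succ_ne_zero j).symm _ _ a b) _ _,
        commute_monodromy (fun j a b => hcomm 0 j.succ (Fin.succ_ne_zero j).symm _ _ a b) _ _⟩
    rw [monodromy_succ]
    simp only [Matrix.mul_apply, Fin.sum_univ_two, h.1.eq, h.2.eq]
    simp [hC, hD, ihC, ihD, smul_smul, pow_succ]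

/-- The coordinate form of the off-shell Bethe vectors of a homogeneous XXX chain with
parameter-independent local creation operators. -/
lemma bethe_vector_eq_sum_betheWave {Λ : Set ℂ} {v : H} {a d : ℂ → ℂ}
    (ha : ∀ x ∈ Λ, a x ≠ 0) (hd : ∀ x ∈ Λ, d x ≠ 0) (N : ℕ) :
    ∀ (L : Fin N → ℂ → Matrix (Fin 2) (Fin 2) (EndH H)) (b : Fin N → EndH H),
      (∀ j, SatisfiesRTT Λ (fun x y => x ≠ y) RXXX (L j)) →
      (∀ i j, i ≠ j → ∀ x y, x ∈ Λ → y ∈ Λ → ∀ a b c d, Commute (L i x a b) (L j y c d)) →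
      (∀ j, ∀ x ∈ Λ, L j x 0 0 v = a x • v) → (∀ j, ∀ x ∈ Λ, L j x 1 1 v = d x • v) →
      (∀ j, ∀ x ∈ Λ, L j x 1 0 v = 0) → (∀ j, b j (b j v) = 0) →
      (∀ j, ∀ x ∈ Λ, L j x 0 1 = b j) →
      ∀ (M : ℕ) (u : Fin M → ℂ), (∀ i, u i ∈ Λ) → Function.Injective u →
        (List.ofFn fun i => monodromy L (u i) 0 1).prod v
          = (∏ i, d (u i) ^ N / a (u i)) •
            ∑ n ∈ Finset.univ.filter (fun n : Fin M → Fin N => ∀ k l, k < l → n k < n l),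
              betheWave (fun x => a x / d x) u n • (List.ofFn fun k => b (n k)).prod v := by
  induction N with
  | zero =>
    intro L b _ _ _ _ _ _ _ M u _ _
    cases M with
    | zero => simp [betheWave]
    | succ M => simp [monodromy, List.ofFn_succ]
  | succ N ih =>
    intro L b hRTT hcomm hA hD hC hbb hb M u hu hinj
    cases M with
    | zero => simp [betheWave]
    | succ M =>
    have hcomm' : ∀ i j : Fin N, i ≠ j → ∀ x y, x ∈ Λ → y ∈ Λ →
        ∀ a b c d, Commute (L i.succ x a b) (L j.succ y c d) := fun i j hij =>
      hcomm i.succ j.succ fun h => hij (Fin.succ_injective _ h)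
    have hT := monodromy_satisfiesRTT (fun j : Fin N => hRTT j.succ) hcomm'
    have hLT : ∀ x ∈ Λ, ∀ y ∈ Λ, ∀ i j k l,
        Commute (L 0 x i j) (monodromy (fun j : Fin N => L j.succ) y k l) :=
      fun x hx y hy i j k l => commute_monodromy
        (fun m p q => hcomm 0 m.succ (Fin.succ_ne_zero m).symm x y hx hy i j p q) k l
    have ih' := ih (fun j => L j.succ) (fun j => b j.succ) (fun j => hRTT j.succ) hcomm'
      (fun j => hA j.succ) (fun j => hD j.succ) (fun j => hC j.succ) (fun j => hbb j.succ)
      (fun j => hb j.succ)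
    have hsplit := bethe_split_first (Λ := Λ) (A := fun x => L 0 x 0 0) (b := b 0) (v := v)
      (a := a) (d := fun x => d x ^ N)
      (B := fun x => monodromy (fun j : Fin N => L j.succ) x 0 1)
      (D := fun x => monodromy (fun j : Fin N => L j.succ) x 1 1)
      (fun x hx y hy => hT.commute_B hx hy) (fun x hx y hy => hT.D_mul_B hx hy)
      (fun x hx => (monodromy_lower_apply (fun j : Fin N => hC j.succ x hx)
        (fun j => hD j.succ x hx) fun i j hij => hcomm' i j hij x x hx hx).2)
      (hA 0) (by
        intro x hx y hy hxy
        have h := LinearMap.congr_fun ((hRTT 0).commutator hy hx hxy.symm 0 1 0 0) v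
        simp only [hb 0 x hx, hb 0 y hy, LinearMap.sub_apply, LinearMap.smul_apply,
          Module.End.mul_apply, hA 0 x hx, hA 0 y hy, map_smul] at h
        rw [sub_eq_iff_eq_add] at h
        rw [fXXX_eq_one_add_gXXX hxy.symm, ← sub_eq_of_eq_add' h]
        module)
      (hbb 0) (fun x hx y hy => hLT x hx y hy _ _ _ _)
      (fun y hy => hb 0 y hy ▸ hLT y hy y hy _ _ _ _)
      (fun y hy => hb 0 y hy ▸ hLT y hy y hy _ _ _ _) M u hu hinj
    have hmon : (fun i => monodromy L (u i) 0 1) = fun i =>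
        L 0 (u i) 0 0 * monodromy (fun j : Fin N => L j.succ) (u i) 0 1
          + b 0 * monodromy (fun j : Fin N => L j.succ) (u i) 1 1 := by
      funext i
      rw [monodromy_succ, Matrix.mul_apply, Fin.sum_univ_two, hb 0 _ (hu i)]
    rw [hmon, hsplit, sum_strictMono_fin_succ, smul_add, ih' _ u hu hinj]
    congr 1
    · rw [smul_smul, Finset.smul_sum, Finset.smul_sum]
      refine Finset.sum_congr rfl fun n _ => ?_
      rw [betheWave_succ, smul_smul, smul_smul, ← mul_assoc, ← Finset.prod_mul_distrib,
        ← Finset.prod_mul_distrib]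
      congr 2
      refine Finset.prod_congr rfl fun i _ => ?_
      have := ha _ (hu i)
      have := hd _ (hu i)
      field_simp
      ring
    · have hterm : ∀ k : Fin (M + 1),
          b 0 ((List.ofFn fun j =>
            monodromy (fun j : Fin N => L j.succ) (u (k.succAbove j)) 0 1).prod v)
          = (∏ j, d (u (k.succAbove j)) ^ N / a (u (k.succAbove j))) •
            ∑ n ∈ Finset.univ.filter (fun n : Fin M → Fin N => ∀ k l, k < l → n k < n l),
              betheWave (fun x => a x / d x) (fun j => u (k.succAbove j)) n •
                b 0 ((List.ofFn fun k => b (n k).succ).prod v) := by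
        intro k
        rw [ih' _ (fun j => u (k.succAbove j)) (fun j => hu _)
          (hinj.comp Fin.succAbove_right_injective)]
        simp only [map_smul, map_sum]
      simp only [hterm, Finset.smul_sum]
      rw [Finset.sum_comm]
      refine Finset.sum_congr rfl fun n _ => ?_
      rw [betheWave_cons_zero]
      simp only [smul_smul, ← Finset.sum_smul, Finset.mul_sum, List.ofFn_succ, Fin.cons_zero,
        Fin.cons_succ, List.prod_cons, Module.End.mul_apply]
      congr 1
      refine Finset.sum_congr rfl fun k _ => ?_
      rw [Fin.prod_univ_succAbove _ k]
      have hprod : (∏ j, a (u (k.succAbove j))) *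
            ∏ j, d (u (k.succAbove j)) ^ N / a (u (k.succAbove j))
          = (∏ j, d (u (k.succAbove j)) ^ (N + 1) / a (u (k.succAbove j))) *
            ∏ j, a (u (k.succAbove j)) / d (u (k.succAbove j)) := by
        rw [← Finset.prod_mul_distrib, ← Finset.prod_mul_distrib]
        refine Finset.prod_congr rfl fun i _ => ?_
        have := ha _ (hu (k.succAbove i))
        have := hd _ (hu (k.succAbove i))
        field_simp
        ring
      have hk : d (u k) ^ N = d (u k) ^ (N + 1) / a (u k) * (a (u k) / d (u k)) := by
        have := ha _ (hu k)
        have := hd _ (hu k)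
        field_simp
        ring
      rw [Finset.prod_mul_distrib]
      linear_combination ((d (u k) ^ N * ∏ j, fXXX (u k) (u (k.succAbove j))) *
          betheWave (fun x => a x / d x) (fun j => u (k.succAbove j)) n) * hprod
        + ((∏ j, fXXX (u k) (u (k.succAbove j))) *
          betheWave (fun x => a x / d x) (fun j => u (k.succAbove j)) n *
          ((∏ j, d (u (k.succAbove j)) ^ (N + 1) / a (u (k.succAbove j))) *
            ∏ j, a (u (k.succAbove j)) / d (u (k.succAbove j)))) * hk

/-- homogeneous chain (`ξ₁ = ⋯ = ξ_N = ξ`) with parameter-independent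
creation operators `Bⱼ(λ) = Bⱼ`, XXX case.  Note that `n : Fin M → Fin N` is
0-indexed, so the exponent `n_k` of the 1-indexed formula is `(n k : ℕ) + 1`. -/
theorem homogeneous_Bethe_vectors_XXX {H : Type} [AddCommGroup H] [Module ℂ H]
    (N : ℕ) (hN : 1 ≤ N) (xi : ℂ) (Λ : Set ℂ)
    (L : Fin N → ℂ → Matrix (Fin 2) (Fin 2) (EndH H))
    (hRTT : ∀ j : Fin N, SatisfiesRTT Λ (fun lam mu => lam ≠ mu) RXXX (L j))
    (hcomm : ∀ i j : Fin N, i ≠ j → ∀ lam mu : ℂ, lam ∈ Λ → mu ∈ Λ →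
      ∀ a b c d : Fin 2, Commute (L i lam a b) (L j mu c d))
    (v0 : H) (hv0 : v0 ≠ 0) (alpha delta : ℂ → ℂ → ℂ)
    (hA : ∀ (j : Fin N) (lam : ℂ), lam ∈ Λ → L j lam 0 0 v0 = alpha lam xi • v0)
    (hD : ∀ (j : Fin N) (lam : ℂ), lam ∈ Λ → L j lam 1 1 v0 = delta lam xi • v0)
    (hC : ∀ (j : Fin N) (lam : ℂ), lam ∈ Λ → L j lam 1 0 v0 = 0)
    (hBB : ∀ (j : Fin N) (lam mu : ℂ), lam ∈ Λ → mu ∈ Λ →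
      (L j lam 0 1) ((L j mu 0 1) v0) = 0)
    (Bc : Fin N → EndH H)
    (hBconst : ∀ (j : Fin N) (lam : ℂ), lam ∈ Λ → L j lam 0 1 = Bc j)
    (M : ℕ) (lam : Fin M → ℂ) (hlam : ∀ i, lam i ∈ Λ)
    (hdist : Function.Injective lam)
    (halpha : ∀ l : Fin M, alpha (lam l) xi ≠ 0)
    (hdelta : ∀ l : Fin M, delta (lam l) xi ≠ 0) :
    ((List.ofFn (fun i : Fin M =>
        (List.ofFn (fun j : Fin N => L j (lam i))).prod 0 1)).prod) v0
      = (∏ l : Fin M, delta (lam l) xi ^ N / alpha (lam l) xi) •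
          ∑ n ∈ Finset.univ.filter
              (fun n : Fin M → Fin N => ∀ k l : Fin M, k < l → n k < n l),
            ((∑ σ : Equiv.Perm (Fin M),
                (∏ i : Fin M, ∏ j ∈ Finset.univ.filter (fun j : Fin M => i < j),
                    fXXX (lam (σ i)) (lam (σ j))) *
                  ∏ k : Fin M,
                    (alpha (lam (σ k)) xi / delta (lam (σ k)) xi) ^ ((n k : ℕ) + 1)) •
              (((List.ofFn (fun k : Fin M => Bc (n k))).prod) v0)) := by
  have hsub : ∀ x ∈ Set.range lam, x ∈ Λ := by
    rintro _ ⟨i, rfl⟩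
    exact hlam i
  rcases Nat.eq_zero_or_pos M with rfl | hM
  · simp
  have hbb : ∀ j, Bc j (Bc j v0) = 0 := fun j => by
    have h := hBB j _ _ (hlam ⟨0, hM⟩) (hlam ⟨0, hM⟩)
    rwa [hBconst j _ (hlam _)] at h
  exact bethe_vector_eq_sum_betheWave (Λ := Set.range lam) (a := fun x => alpha x xi)
    (d := fun x => delta x xi) (Set.forall_mem_range.mpr halpha) (Set.forall_mem_range.mpr hdelta)
    N L Bc (fun j x y hx hy => hRTT j x y (hsub x hx) (hsub y hy))
    (fun i j hij x y hx hy => hcomm i j hij x y (hsub x hx) (hsub y hy))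
    (fun j x hx => hA j x (hsub x hx)) (fun j x hx => hD j x (hsub x hx))
    (fun j x hx => hC j x (hsub x hx)) hbb (fun j x hx => hBconst j x (hsub x hx))
    M lam Set.mem_range_self hdist

end
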